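/- Let k be an algebraically closed field of characteristic p > 2. For every i ≥ 1, the i-th Frobenius Betti number of R equals 4·3^(i−1); that is, the sequence e ↦ dim_k Tor_i^R(^eR, R/𝔪) / p^(3e) converges to 4·3^(i−1) as e → ∞. -/

import Mathlib

open MvPolynomial CategoryTheory Filter

set_option synthInstance.maxHeartbeats 1000000
set_option maxHeartbeats 2000000

noncomputable section

variable (k : Type) [Field k]

/-- `R = k[x², y², z², xy, xz, yz]`, the second Veronese subalgebra of `S = k[x,y,z]`. -/
def Rv2 : Subalgebra k (MvPolynomial (Fin 3) k) :=
  Algebra.adjoin k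
    {X 0 ^ 2, X 1 ^ 2, X 2 ^ 2, X 0 * X 1, X 0 * X 2, X 1 * X 2}

/-- The graded maximal ideal `𝔪 = ⊕_{n≥1} S_{2n}` of `R`: the elements of `R` with zero
constant term. -/
def mV2 : Ideal ↥(Rv2 k) :=
  RingHom.ker ((constantCoeff : MvPolynomial (Fin 3) k →+* k).comp (Rv2 k).val.toRingHom)

/-- The `i`-th Betti number `β_i(M) = dim_k Tor_i^R(M, R/𝔪)` of an `R`-module `M`. -/
def bettiV2 (i : ℕ) (M : Type) [AddCommGroup M] [Module ↥(Rv2 k) M] : ℕ :=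
  Module.finrank k (RestrictScalars k ↥(Rv2 k)
    ((((Tor (ModuleCat ↥(Rv2 k)) i).obj (ModuleCat.of ↥(Rv2 k) M)).obj
      (ModuleCat.of ↥(Rv2 k) (↥(Rv2 k) ⧸ mV2 k)))))

/-- The `e`-th iterated Frobenius endomorphism `r ↦ r^(p^e)` of `R`. -/
def frobRv2 (p : ℕ) [Fact p.Prime] [CharP k p] (e : ℕ) : ↥(Rv2 k) →+* ↥(Rv2 k) :=
  letI : CharP ↥(Rv2 k) p :=
    CharP.subsemiring (MvPolynomial (Fin 3) k) p (Rv2 k).toSubsemiring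
  iterateFrobenius ↥(Rv2 k) p e

/-- `^eR` : `R` viewed as an `R`-module by restriction of scalars along the `e`-th iterate
of the Frobenius endomorphism. -/
def eRv2 (p : ℕ) [Fact p.Prime] [CharP k p] (e : ℕ) : ModuleCat ↥(Rv2 k) :=
  (ModuleCat.restrictScalars (frobRv2 k p e)).obj (ModuleCat.of ↥(Rv2 k) ↥(Rv2 k))

namespace TorResolution
open Limits MonoidalCategory

variable {A : Type} [CommRing A] {K : ModuleCat.{0} A} (P : ProjectiveResolution K)

/-- The functor `M ↦ M ⊗ P` to chain complexes. -/
def tensorComplex : ModuleCat.{0} A ⥤ ChainComplex (ModuleCat.{0} A) ℕ where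
  obj M := ((tensorLeft M).mapHomologicalComplex _).obj P.complex
  map f := (NatTrans.mapHomologicalComplex ((tensoringLeft _).map f) _).app P.complex
  map_id M := by
    ext n : 1
    exact MonoidalCategory.id_whiskerRight _ _
  map_comp f g := by
    ext n : 1
    exact MonoidalCategory.comp_whiskerRight _ _ _

instance : (tensorComplex P).Additive where
  map_add {M N f g} := by
    ext n : 1
    exact MonoidalPreadditive.add_whiskerRight (C := ModuleCat.{0} A) f g

/-- `M ↦ Tor_n(M, K)` computed with the resolution `P` of `K`. -/
def torFunctor (n : ℕ) : ModuleCat.{0} A ⥤ ModuleCat.{0} A :=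
  tensorComplex P ⋙ HomologicalComplex.homologyFunctor _ _ n

instance (n : ℕ) : (torFunctor P n).Additive := by
  unfold torFunctor; infer_instance

/-- `Tor` is computed by any projective resolution of the second argument. -/
def torIso (n : ℕ) (M : ModuleCat.{0} A) :
    ((Tor (ModuleCat.{0} A) n).obj M).obj K ≅ (torFunctor P n).obj M :=
  P.isoLeftDerivedObj (tensorLeft M) n

lemma flat_complex_X (n : ℕ) : Module.Flat A (P.complex.X n) := by
  have := P.projective n
  have : Module.Projective A (P.complex.X n) := (IsProjective.iff_projective _).2 this
  infer_instance

lemma isZero_torFunctor_succ (M : ModuleCat.{0} A) [Module.Flat A M] (n : ℕ) :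
    IsZero ((torFunctor P (n + 1)).obj M) := by
  have h := Module.Flat.lTensor_shortComplex_exact M _ (P.exact_succ n)
  have h2 : (((tensorComplex P).obj M).sc' (n + 2) (n + 1) n).Exact := h
  exact ((HomologicalComplex.exactAt_iff' _ _ _ _ (by simp) (by simp)).2 h2).isZero_homology

lemma shortExact_tensorComplex {S : ShortComplex (ModuleCat.{0} A)} (hS : S.ShortExact) :
    (S.map (tensorComplex P)).ShortExact := by
  refine HomologicalComplex.shortExact_of_degreewise_shortExact _ fun n => ?_
  have := flat_complex_X P n
  have h := hS.map_of_exact (tensorRight (P.complex.X n))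
  exact h

/-- The augmentation `H_0(M ⊗ P) ⟶ M ⊗ K`. -/
def augmentation (M : ModuleCat.{0} A) :
    ((tensorComplex P).obj M).opcycles 0 ⟶ (tensorRight K).obj M :=
  P.fromLeftDerivedZero' (tensorLeft M)

instance (M : ModuleCat.{0} A) : IsIso (augmentation P M) := by
  have : PreservesFiniteColimits (tensorLeft M) := inferInstance
  exact inferInstanceAs (IsIso (P.fromLeftDerivedZero' (tensorLeft M)))

lemma pOpcycles_augmentation (M : ModuleCat.{0} A) :
    ((tensorComplex P).obj M).pOpcycles 0 ≫ augmentation P M = M ◁ (P.π.f 0) :=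
  P.pOpcycles_comp_fromLeftDerivedZero' (tensorLeft M)

lemma opcyclesMap_augmentation {M N : ModuleCat.{0} A} (f : M ⟶ N) :
    HomologicalComplex.opcyclesMap ((tensorComplex P).map f) 0 ≫ augmentation P N =
      augmentation P M ≫ (tensorRight K).map f := by
  rw [← cancel_epi (HomologicalComplex.pOpcycles _ _),
    HomologicalComplex.p_opcyclesMap_assoc, pOpcycles_augmentation]
  refine Eq.trans ?_ (congrArg (· ≫ (f ▷ K)) (pOpcycles_augmentation P M)).symm
  exact (whisker_exchange f (P.π.f 0)).symm

/-- The degree-zero part of `Tor` is the tensor product. -/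
def torZeroIso : torFunctor P 0 ≅ tensorRight K :=
  NatIso.ofComponents (fun M =>
    ChainComplex.isoHomologyι₀ ((tensorComplex P).obj M) ≪≫ asIso (augmentation P M)) (by
    intro M N f
    exact (HomologicalComplex.homologyι_naturality_assoc ((tensorComplex P).map f) 0
      (augmentation P N)).trans ((congrArg (HomologicalComplex.homologyι _ 0 ≫ ·)
        (opcyclesMap_augmentation P f)).trans (Category.assoc _ _ _).symm))

section LongExact

variable {S : ShortComplex (ModuleCat.{0} A)}

lemma nonempty_iso_of_isZero (hS : S.ShortExact) (n : ℕ)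
    (h₁ : IsZero ((torFunctor P (n + 1)).obj S.X₂))
    (h₂ : (torFunctor P n).map S.f = 0) :
    Nonempty ((torFunctor P (n + 1)).obj S.X₃ ≅ (torFunctor P n).obj S.X₁) := by
  have hT := shortExact_tensorComplex P hS
  have hn : (ComplexShape.down ℕ).Rel (n + 1) n := rfl
  have : Mono (hT.δ (n + 1) n hn) := hT.mono_δ _ _ rfl h₁
  have : Epi (hT.δ (n + 1) n hn) := (hT.homology_exact₁ (n + 1) n hn).epi_f h₂
  have := isIso_of_mono_of_epi (hT.δ (n + 1) n hn)
  exact ⟨@asIso _ _ _ _ _ this⟩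

lemma torFunctor_exact (hS : S.ShortExact) (n : ℕ) : (S.map (torFunctor P n)).Exact :=
  (shortExact_tensorComplex P hS).homology_exact₂ n

lemma nonempty_iso_of_mono (hS : S.ShortExact) (n : ℕ)
    (h₁ : IsZero ((torFunctor P (n + 1)).obj S.X₁))
    (h₂ : Mono ((torFunctor P n).map S.f)) :
    Nonempty ((torFunctor P (n + 1)).obj S.X₂ ≅ (torFunctor P (n + 1)).obj S.X₃) := by
  have hT := shortExact_tensorComplex P hS
  have hn : (ComplexShape.down ℕ).Rel (n + 1) n := rfl
  have h0 : hT.δ (n + 1) n hn = 0 := by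
    have h2 : Mono (HomologicalComplex.homologyMap (S.map (tensorComplex P)).f n) := h₂
    rw [← cancel_mono (HomologicalComplex.homologyMap (S.map (tensorComplex P)).f n),
      hT.δ_comp, zero_comp]
  let φ := (torFunctor P (n + 1)).map S.g
  have : Mono φ := (torFunctor_exact P hS (n + 1)).mono_g (h₁.eq_of_src _ _)
  have : Epi φ := (hT.homology_exact₃ (n + 1) n hn).epi_f h0
  have := isIso_of_mono_of_epi φ
  exact ⟨asIso φ⟩

end LongExact

lemma nonempty_torFunctor_pi_equiv (n : ℕ) {J : Type} [Finite J] (M : J → ModuleCat.{0} A) :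
    Nonempty ((torFunctor P n).obj (ModuleCat.of A (∀ j, M j)) ≅
      ModuleCat.of A (∀ j, (torFunctor P n).obj (M j))) :=
  ⟨(torFunctor P n).mapIso (ModuleCat.biproductIsoPi M).symm ≪≫
    (torFunctor P n).mapBiproduct M ≪≫ ModuleCat.biproductIsoPi _⟩

end TorResolution

section HasDim
variable {A : Type} [CommRing A] [Algebra k A]

/-- The `A`-module `V` has finite dimension `d` over the field `k`. -/
def HasDim (V : Type) [AddCommGroup V] [Module A V] (d : ℕ) : Prop :=
  letI : Module k V := Module.compHom V (algebraMap k A)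
  Module.Finite k V ∧ Module.finrank k V = d

variable {k} {V W U : Type} [AddCommGroup V] [Module A V] [AddCommGroup W] [Module A W]
  [AddCommGroup U] [Module A U]

lemma HasDim.finrank_restrictScalars {d : ℕ} (h : HasDim (A := A) k V d) :
    Module.finrank k (RestrictScalars k A V) = d :=
  h.2

lemma hasDim_iff [Module k V] [IsScalarTower k A V] {d : ℕ} :
    HasDim (A := A) k V d ↔ Module.Finite k V ∧ Module.finrank k V = d := by
  have : (‹Module k V› : Module k V) = Module.compHom V (algebraMap k A) := by
    ext c v
    exact (algebraMap_smul A c v).symm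
  subst this
  rfl

lemma HasDim.congr {d : ℕ} (h : HasDim (A := A) k V d) (e : V ≃ₗ[A] W) :
    HasDim (A := A) k W d := by
  let : Module k V := Module.compHom V (algebraMap k A)
  let : Module k W := Module.compHom W (algebraMap k A)
  have : IsScalarTower k A V := IsScalarTower.of_compHom k A V
  have : IsScalarTower k A W := IsScalarTower.of_compHom k A W
  rw [hasDim_iff] at h ⊢
  have := h.1
  have e' := e.restrictScalars k
  exact ⟨Module.Finite.equiv e', e'.finrank_eq ▸ h.2⟩

lemma HasDim.of_subsingleton [Subsingleton V] : HasDim (A := A) k V 0 := by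
  let : Module k V := Module.compHom V (algebraMap k A)
  exact ⟨inferInstance, Module.finrank_zero_of_subsingleton⟩

lemma HasDim.pi {J : Type} [Fintype J] {V : J → Type} [∀ j, AddCommGroup (V j)]
    [∀ j, Module A (V j)] {d : J → ℕ} (h : ∀ j, HasDim (A := A) k (V j) (d j)) :
    HasDim (A := A) k (∀ j, V j) (∑ j, d j) := by
  let (j : J) : Module k (V j) := Module.compHom (V j) (algebraMap k A)
  have (j : J) : IsScalarTower k A (V j) := IsScalarTower.of_compHom k A (V j)
  simp only [hasDim_iff] at h ⊢
  have := fun j => (h j).1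
  exact ⟨inferInstance, by
    rw [Module.finrank_pi_fintype]
    exact Finset.sum_congr rfl fun j _ => (h j).2⟩

lemma HasDim.of_exact {a b : ℕ} {f : V →ₗ[A] W} {g : W →ₗ[A] U} (hf : Function.Injective f)
    (hg : Function.Surjective g) (hfg : Function.Exact f g) (hV : HasDim (A := A) k V a)
    (hW : HasDim (A := A) k W (a + b)) : HasDim (A := A) k U b := by
  let : Module k V := Module.compHom V (algebraMap k A)
  let : Module k W := Module.compHom W (algebraMap k A)
  let : Module k U := Module.compHom U (algebraMap k A)
  have : IsScalarTower k A V := IsScalarTower.of_compHom k A V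
  have : IsScalarTower k A W := IsScalarTower.of_compHom k A W
  have : IsScalarTower k A U := IsScalarTower.of_compHom k A U
  rw [hasDim_iff] at hV hW ⊢
  obtain ⟨_, hV⟩ := hV
  obtain ⟨_, hW⟩ := hW
  let f' := f.restrictScalars k
  let g' := g.restrictScalars k
  have hfg' : Function.Exact f' g' := hfg
  refine ⟨Module.Finite.of_surjective g' hg, ?_⟩
  have h1 := LinearMap.finrank_range_add_finrank_ker g'
  rw [LinearMap.range_eq_top (f := g') |>.2 hg, finrank_top, LinearMap.exact_iff.1 hfg',
    LinearMap.finrank_range_of_inj (f := f') hf, hV, hW] at h1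
  omega

end HasDim

namespace TorResolution
open Limits MonoidalCategory TensorProduct

variable {k} {A : Type} [CommRing A] [Algebra k A]

lemma epi_torFunctor_zero_map {K : ModuleCat.{0} A} (P : ProjectiveResolution K)
    {M N : ModuleCat.{0} A} (f : M ⟶ N) [Epi f] : Epi ((torFunctor P 0).map f) := by
  have h : Epi ((tensorRight K).map f) := (ModuleCat.epi_iff_surjective _).2
    (LinearMap.rTensor_surjective K ((ModuleCat.epi_iff_surjective f).1 inferInstance))
  have h2 := (torZeroIso P).hom.naturality f
  have : Epi ((torFunctor P 0).map f ≫ (torZeroIso P).hom.app N) := by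
    rw [h2]; infer_instance
  have h3 : (torFunctor P 0).map f =
      ((torFunctor P 0).map f ≫ (torZeroIso P).hom.app N) ≫ (torZeroIso P).inv.app N := by
    rw [Category.assoc, Iso.hom_inv_id_app, Category.comp_id]
  rw [h3]
  infer_instance

lemma torFunctor_zero_map_eq_zero {K : ModuleCat.{0} A} (P : ProjectiveResolution K)
    {M N : ModuleCat.{0} A} (f : M ⟶ N) (h : (tensorRight K).map f = 0) :
    (torFunctor P 0).map f = 0 := by
  have h2 := (torZeroIso P).hom.naturality f
  rw [h, comp_zero] at h2
  rw [← cancel_mono ((torZeroIso P).hom.app N), h2, zero_comp]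

variable {I : Ideal A}
  (P : ProjectiveResolution (ModuleCat.of A (A ⧸ I)))
  {F E N : Type} [AddCommGroup F] [Module A F] [AddCommGroup E] [Module A E]
  [AddCommGroup N] [Module A N]

lemma rTensor_eq_zero_of_coord_mem (e : A ≃ₗ[A] F) {ι : Type} [Finite ι] (f : N →ₗ[A] (ι → F))
    (hf : ∀ x i, e.symm (f x i) ∈ I) : f.rTensor (A ⧸ I) = 0 := by
  classical
  have := Fintype.ofFinite ι
  refine TensorProduct.ext' fun x b => ?_
  have h : f x = ∑ i, e.symm (f x i) • Pi.single i (e 1) := by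
    ext j
    simp [Finset.sum_apply, Pi.single_apply, ← map_smul]
  rw [LinearMap.rTensor_tmul, LinearMap.zero_apply, h, sum_tmul]
  refine Finset.sum_eq_zero fun i _ => ?_
  obtain ⟨b, rfl⟩ := Ideal.Quotient.mk_surjective b
  have h0 : e.symm (f x i) • (Ideal.Quotient.mk I b) = 0 :=
    Ideal.Quotient.eq_zero_iff_mem.2 (I.mul_mem_right b (hf x i))
  rw [smul_tmul, h0, tmul_zero]

lemma hasDim_of_iso {V W : ModuleCat.{0} A} {d : ℕ} (h : HasDim (A := A) k V d) (e : V ≅ W) :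
    HasDim (A := A) k W d :=
  h.congr e.toLinearEquiv

lemma hasDim_torFunctor_pi {n d : ℕ} (h : HasDim (A := A) k ((torFunctor P n).obj (.of A E)) d) :
    HasDim (A := A) k ((torFunctor P n).obj (.of A (Fin 3 → E))) (3 * d) := by
  obtain ⟨i⟩ := nonempty_torFunctor_pi_equiv P n (fun _ : Fin 3 => ModuleCat.of A E)
  have := HasDim.pi (fun _ : Fin 3 => h)
  simp only [Finset.sum_const, Finset.card_univ, Fintype.card_fin, smul_eq_mul] at this
  exact hasDim_of_iso this i.symm

lemma hasDim_torFunctor_zero_of_equiv (e : A ≃ₗ[A] F) (hI : HasDim (A := A) k (A ⧸ I) 1) :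
    HasDim (A := A) k ((torFunctor P 0).obj (.of A F)) 1 := by
  refine hasDim_of_iso ?_ ((torZeroIso P).app (ModuleCat.of A F)).symm
  exact hI.congr ((TensorProduct.lid A (A ⧸ I)).symm ≪≫ₗ e.rTensor (A ⧸ I))

/-- Betti numbers of `E` from two short exact sequences `0 → N → F³ → E → 0` and
`0 → F → E³ → N → 0` with `F` free of rank one. -/
theorem hasDim_torFunctor_succ (hI : HasDim (A := A) k (A ⧸ I) 1) (e : A ≃ₗ[A] F)
    {f₁ : N →ₗ[A] (Fin 3 → F)} {g₁ : (Fin 3 → F) →ₗ[A] E}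
    (hf₁ : Function.Injective f₁) (hg₁ : Function.Surjective g₁) (h₁ : Function.Exact f₁ g₁)
    {f₂ : F →ₗ[A] (Fin 3 → E)} {g₂ : (Fin 3 → E) →ₗ[A] N}
    (hf₂ : Function.Injective f₂) (hg₂ : Function.Surjective g₂) (h₂ : Function.Exact f₂ g₂)
    (hmem : ∀ x i, e.symm (f₁ x i) ∈ I) (hcomp : ∀ x, f₂ x 0 = g₁ (Pi.single 0 x)) (n : ℕ) :
    HasDim (A := A) k ((torFunctor P (n + 1)).obj (.of A E)) (8 * 3 ^ n) := by
  have : Module.Free A F := Module.Free.of_equiv e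
  have : Module.Flat A (ModuleCat.of A F) := inferInstanceAs (Module.Flat A F)
  have : Module.Flat A (ModuleCat.of A (Fin 3 → F)) := inferInstanceAs (Module.Flat A (Fin 3 → F))
  let S₁ := ModuleCat.shortComplexOfCompEqZero f₁ g₁ h₁.linearMap_comp_eq_zero
  let S₂ := ModuleCat.shortComplexOfCompEqZero f₂ g₂ h₂.linearMap_comp_eq_zero
  have hS₁ : S₁.ShortExact := ModuleCat.shortComplex_shortExact S₁ h₁ hf₁ hg₁
  have hS₂ : S₂.ShortExact := ModuleCat.shortComplex_shortExact S₂ h₂ hf₂ hg₂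
  have z₁ (n : ℕ) : IsZero ((torFunctor P (n + 1)).obj S₁.X₂) :=
    isZero_torFunctor_succ P (.of A (Fin 3 → F)) n
  have z₂ (n : ℕ) : IsZero ((torFunctor P (n + 1)).obj S₂.X₁) :=
    isZero_torFunctor_succ P (.of A F) n
  have hz : (torFunctor P 0).map S₁.f = 0 :=
    torFunctor_zero_map_eq_zero P S₁.f
      (ModuleCat.hom_ext (rTensor_eq_zero_of_coord_mem (I := I) e f₁ hmem))
  have hm₁ : Mono ((torFunctor P 0).map S₁.g) := (torFunctor_exact P hS₁ 0).mono_g hz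
  have := hS₁.epi_g
  have he₁ : Epi ((torFunctor P 0).map S₁.g) := epi_torFunctor_zero_map P S₁.g
  have hi₁ := isIso_of_mono_of_epi ((torFunctor P 0).map S₁.g)
  have hF := hasDim_torFunctor_zero_of_equiv P e hI
  have hE : HasDim (A := A) k ((torFunctor P 0).obj (.of A E)) 3 :=
    hasDim_of_iso (hasDim_torFunctor_pi P hF) (@asIso _ _ _ _ _ hi₁)
  have hm₂ : Mono ((torFunctor P 0).map S₂.f) := by
    let π : S₂.X₂ ⟶ .of A E := ModuleCat.ofHom (LinearMap.proj 0)
    let s : S₂.X₁ ⟶ S₁.X₂ := ModuleCat.ofHom (LinearMap.single A (fun _ : Fin 3 => F) 0)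
    let r : S₁.X₂ ⟶ S₂.X₁ := ModuleCat.ofHom (LinearMap.proj 0)
    have hsr : s ≫ r = 𝟙 _ := by
      ext x
      exact Pi.single_eq_same (M := fun _ : Fin 3 => F) 0 x
    have hfac : S₂.f ≫ π = s ≫ S₁.g := by
      ext x
      exact hcomp x
    have : Mono ((torFunctor P 0).map s) := by
      have : Mono ((torFunctor P 0).map s ≫ (torFunctor P 0).map r) := by
        rw [← Functor.map_comp, hsr, CategoryTheory.Functor.map_id]; infer_instance
      exact mono_of_mono _ ((torFunctor P 0).map r)
    have : Mono ((torFunctor P 0).map S₂.f ≫ (torFunctor P 0).map π) := by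
      rw [← Functor.map_comp, hfac, Functor.map_comp]
      exact mono_comp _ _
    exact mono_of_mono _ ((torFunctor P 0).map π)
  have hN : HasDim (A := A) k ((torFunctor P 0).obj (.of A N)) 8 := by
    have := hS₂.epi_g
    have he₂ : Epi ((torFunctor P 0).map S₂.g) := epi_torFunctor_zero_map P S₂.g
    exact HasDim.of_exact (a := 1) ((ModuleCat.mono_iff_injective _).1 hm₂)
      ((ModuleCat.epi_iff_surjective _).1 he₂)
      ((ShortComplex.ShortExact.moduleCat_exact_iff_function_exact _).1
        (torFunctor_exact P hS₂ 0)) hF (hasDim_torFunctor_pi P hE)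
  induction n with
  | zero =>
    obtain ⟨i⟩ := nonempty_iso_of_isZero P hS₁ 0 (z₁ 0) hz
    exact hasDim_of_iso hN i.symm
  | succ n ih =>
    obtain ⟨i⟩ := nonempty_iso_of_isZero P hS₁ (n + 1) (z₁ (n + 1)) ((z₁ n).eq_of_tgt _ _)
    obtain ⟨j⟩ := nonempty_iso_of_mono P hS₂ n (z₂ n) (by
      cases n with
      | zero => exact hm₂
      | succ n => exact ⟨fun _ _ _ => (z₂ n).eq_of_tgt _ _⟩)
    have := hasDim_of_iso (hasDim_torFunctor_pi P ih) (j ≪≫ i.symm)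
    rwa [show 8 * 3 ^ (n + 1) = 3 * (8 * 3 ^ n) by ring]

end TorResolution

section Parity
variable {k}

/-- The grading of `k[x,y,z]` by the parity of the degree. -/
abbrev HasParity (f : MvPolynomial (Fin 3) k) (a : ZMod 2) : Prop :=
  IsWeightedHomogeneous (1 : Fin 3 → ZMod 2) f a

lemma weight_eq_sum (d : Fin 3 →₀ ℕ) :
    Finsupp.weight (1 : Fin 3 → ZMod 2) d = ((d 0 + d 1 + d 2 : ℕ) : ZMod 2) := by
  simp [Finsupp.weight_eq_sum, Fin.sum_univ_three]

lemma hasParity_of_mem {f : MvPolynomial (Fin 3) k} (hf : f ∈ Rv2 k) : HasParity f 0 := by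
  have hX (i j : Fin 3) : HasParity (X i * X j : MvPolynomial (Fin 3) k) 0 :=
    (isWeightedHomogeneous_X k _ i).mul (isWeightedHomogeneous_X k _ j)
  induction hf using Algebra.adjoin_induction with
  | mem f hf =>
    simp only [Set.mem_insert_iff, Set.mem_singleton_iff, pow_two] at hf
    rcases hf with rfl | rfl | rfl | rfl | rfl | rfl <;> exact hX _ _
  | algebraMap r => exact isWeightedHomogeneous_C _ r
  | add f g _ _ hf hg => exact hf.add hg
  | mul f g _ _ hf hg => exact (add_zero (0 : ZMod 2)) ▸ hf.mul hg

lemma mem_of_hasParity {f : MvPolynomial (Fin 3) k} (hf : HasParity f 0) : f ∈ Rv2 k := by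
  rw [f.as_sum]
  refine Subalgebra.sum_mem _ fun d hd => ?_
  have h := hf (mem_support_iff.1 hd)
  rw [weight_eq_sum, ZMod.natCast_eq_zero_iff_even] at h
  have hg {f : MvPolynomial (Fin 3) k}
      (h : f ∈ ({X 0 ^ 2, X 1 ^ 2, X 2 ^ 2, X 0 * X 1, X 0 * X 2, X 1 * X 2} :
        Set (MvPolynomial (Fin 3) k))) : f ∈ Rv2 k := Algebra.subset_adjoin h
  have hsq (i : Fin 3) (n : ℕ) : (X i ^ (n + n) : MvPolynomial (Fin 3) k) ∈ Rv2 k := by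
    rw [← two_mul, pow_mul]
    refine pow_mem (hg ?_) n
    fin_cases i <;> simp
  have h01 : (X 0 * X 1 : MvPolynomial (Fin 3) k) ∈ Rv2 k := hg (by simp)
  have h02 : (X 0 * X 2 : MvPolynomial (Fin 3) k) ∈ Rv2 k := hg (by simp)
  have h12 : (X 1 * X 2 : MvPolynomial (Fin 3) k) ∈ Rv2 k := hg (by simp)
  rw [monomial_eq, Finsupp.prod_fintype _ _ (by simp), Fin.prod_univ_three]
  refine mul_mem ((Rv2 k).algebraMap_mem _) ?_
  rcases Nat.even_or_odd (d 0) with ⟨a, ha⟩ | ⟨a, ha⟩ <;>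
  rcases Nat.even_or_odd (d 1) with ⟨b, hb⟩ | ⟨b, hb⟩ <;>
  rcases Nat.even_or_odd (d 2) with ⟨c, hc⟩ | ⟨c, hc⟩ <;>
  rw [ha, hb, hc] at h ⊢
  · exact mul_mem (mul_mem (hsq _ _) (hsq _ _)) (hsq _ _)
  · grind
  · grind
  · rw [show (X 0 ^ (a + a) * X 1 ^ (2 * b + 1) * X 2 ^ (2 * c + 1) : MvPolynomial (Fin 3) k) =
      X 0 ^ (a + a) * X 1 ^ (b + b) * X 2 ^ (c + c) * (X 1 * X 2) by ring]
    exact mul_mem (mul_mem (mul_mem (hsq _ _) (hsq _ _)) (hsq _ _)) h12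
  · grind
  · rw [show (X 0 ^ (2 * a + 1) * X 1 ^ (b + b) * X 2 ^ (2 * c + 1) : MvPolynomial (Fin 3) k) =
      X 0 ^ (a + a) * X 1 ^ (b + b) * X 2 ^ (c + c) * (X 0 * X 2) by ring]
    exact mul_mem (mul_mem (mul_mem (hsq _ _) (hsq _ _)) (hsq _ _)) h02
  · rw [show (X 0 ^ (2 * a + 1) * X 1 ^ (2 * b + 1) * X 2 ^ (c + c) : MvPolynomial (Fin 3) k) =
      X 0 ^ (a + a) * X 1 ^ (b + b) * X 2 ^ (c + c) * (X 0 * X 1) by ring]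
    exact mul_mem (mul_mem (mul_mem (hsq _ _) (hsq _ _)) (hsq _ _)) h01
  · grind

lemma mem_Rv2_iff {f : MvPolynomial (Fin 3) k} : f ∈ Rv2 k ↔ HasParity f 0 :=
  ⟨hasParity_of_mem, mem_of_hasParity⟩

instance : CommRing (Rv2 k) := inferInstance

instance : Module (Rv2 k) (MvPolynomial (Fin 3) k) := inferInstance

variable (k) in
/-- The `R`-submodule of polynomials all of whose monomials have degree of parity `a`. -/
def paritySubmodule (a : ZMod 2) : Submodule (Rv2 k) (MvPolynomial (Fin 3) k) where
  carrier := {f | HasParity f a}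
  add_mem' hf hg := hf.add hg
  zero_mem' := isWeightedHomogeneous_zero _ _ _
  smul_mem' r _ hf := zero_add a ▸ (mem_Rv2_iff.1 r.2).mul hf

variable (k) in
/-- The `R`-module of polynomials all of whose monomials have degree of parity `a`. -/
def ParityPart (a : ZMod 2) : Type := paritySubmodule k a

namespace ParityPart
variable {a b : ZMod 2}

instance : AddCommGroup (ParityPart k a) := inferInstanceAs (AddCommGroup (paritySubmodule k a))

instance : Module (Rv2 k) (ParityPart k a) := inferInstanceAs (Module _ (paritySubmodule k a))

/-- The polynomial underlying an element of the part of parity `a`. -/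
def val : ParityPart k a →+ MvPolynomial (Fin 3) k :=
  (paritySubmodule k a).toAddSubgroup.subtype

/-- A polynomial of parity `a` as an element of the corresponding part. -/
def mk (f : MvPolynomial (Fin 3) k) (hf : HasParity f a) : ParityPart k a := ⟨f, hf⟩

@[simp]
lemma val_mk (f : MvPolynomial (Fin 3) k) (hf : HasParity f a) : (mk f hf).val = f := rfl

lemma val_smul (r : Rv2 k) (f : ParityPart k a) : (r • f).val = r.1 * f.val := rfl

lemma hasParity (f : ParityPart k a) : HasParity f.val a := f.2

@[ext]
lemma ext {f g : ParityPart k a} (h : f.val = g.val) : f = g := Subtype.ext h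

variable (k) in
/-- The even part is `R` itself. -/
def evenEquiv : Rv2 k ≃ₗ[Rv2 k] ParityPart k 0 where
  toFun r := mk r.1 (mem_Rv2_iff.1 r.2)
  map_add' _ _ := rfl
  map_smul' _ _ := rfl
  invFun f := ⟨f.1, mem_Rv2_iff.2 f.2⟩
  left_inv _ := rfl
  right_inv _ := rfl

/-- Multiplication by a variable changes the parity. -/
def mulX (i : Fin 3) (h : 1 + a = b) : ParityPart k a →ₗ[Rv2 k] ParityPart k b where
  toFun f := mk (X i * f.val) (h ▸ (isWeightedHomogeneous_X k _ i).mul f.hasParity)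
  map_add' f g := ext (by simp [mul_add])
  map_smul' r f := ext (by simp [val_smul, mul_left_comm])

@[simp]
lemma val_mulX (i : Fin 3) (h : 1 + a = b) (f : ParityPart k a) :
    (mulX i h f).val = X i * f.val := rfl

end ParityPart

/-- The projection of a polynomial onto its part of parity `a`. -/
abbrev parityComponent (a : ZMod 2) (f : MvPolynomial (Fin 3) k) : MvPolynomial (Fin 3) k :=
  weightedHomogeneousComponent (1 : Fin 3 → ZMod 2) a f

lemma parityComponent_X_mul (i : Fin 3) {a b : ZMod 2} (h : 1 + a = b)
    (f : MvPolynomial (Fin 3) k) :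
    parityComponent b (X i * f) = X i * parityComponent a f := by
  ext d
  rw [coeff_weightedHomogeneousComponent, coeff_X_mul', coeff_X_mul',
    coeff_weightedHomogeneousComponent]
  by_cases hi : i ∈ d.support
  · obtain ⟨d, rfl⟩ : ∃ d', d = Finsupp.single i 1 + d' :=
      ⟨_, (add_tsub_cancel_of_le (Finsupp.single_le_iff.2
        (Nat.one_le_iff_ne_zero.2 (Finsupp.mem_support_iff.1 hi)))).symm⟩
    have : Finsupp.weight (1 : Fin 3 → ZMod 2) (Finsupp.single i 1 + d) =
      1 + Finsupp.weight (1 : Fin 3 → ZMod 2) d := by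
      rw [map_add, Finsupp.weight_single, one_smul, Pi.one_apply]
    simp [hi, this, ← h]
  · simp [hi]

lemma HasParity.component_eq {f : MvPolynomial (Fin 3) k} {a : ZMod 2} (hf : HasParity f a) :
    parityComponent a f = f :=
  IsWeightedHomogeneous.weightedHomogeneousComponent_same hf

lemma exists_cross_of_sum_eq_zero {a b c : MvPolynomial (Fin 3) k}
    (h : X 0 * a + X 1 * b + X 2 * c = 0) :
    ∃ u v w, X 1 * w - X 2 * v = a ∧ X 2 * u - X 0 * w = b ∧ X 0 * v - X 1 * u = c := by
  have hmem : a ∈ Ideal.span (X '' {1, 2} : Set (MvPolynomial (Fin 3) k)) := by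
    have h0 : X 0 * a ∈ Ideal.span (X '' {1, 2} : Set (MvPolynomial (Fin 3) k)) := by
      rw [Set.image_pair, Ideal.mem_span_pair]
      exact ⟨-b, -c, by linear_combination -h⟩
    rw [mem_ideal_span_X_image] at h0 ⊢
    intro m hm
    obtain ⟨i, hi, hmi⟩ := h0 (Finsupp.single 0 1 + m) (by
      rw [mem_support_iff] at hm ⊢
      rwa [coeff_X_mul])
    refine ⟨i, hi, ?_⟩
    rcases hi with rfl | rfl <;> simpa using hmi
  rw [Set.image_pair, Ideal.mem_span_pair] at hmem
  obtain ⟨w, v, rfl⟩ := hmem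
  have h1 : X 1 * (X 0 * w + b) = X 2 * -(X 0 * v + c) := by linear_combination h
  have h2 : (X 2 : MvPolynomial (Fin 3) k) ∣ X 0 * w + b :=
    (X_prime.dvd_or_dvd (Dvd.intro _ h1.symm)).resolve_left (by simp [X_dvd_X])
  obtain ⟨u, hu⟩ := h2
  refine ⟨u, -v, w, by ring, by linear_combination -hu, ?_⟩
  rw [hu] at h1
  apply mul_left_cancel₀ (X_ne_zero (R := k) (2 : Fin 3))
  linear_combination -h1

lemma exists_eq_mul_of_cross_eq_zero {u v w : MvPolynomial (Fin 3) k}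
    (h₀ : X 1 * w - X 2 * v = 0) (h₂ : X 0 * v - X 1 * u = 0) :
    ∃ t, u = X 0 * t ∧ v = X 1 * t ∧ w = X 2 * t := by
  have h : (X 1 : MvPolynomial (Fin 3) k) ∣ v :=
    (X_prime.dvd_or_dvd (Dvd.intro _ (sub_eq_zero.1 h₀))).resolve_left (by simp [X_dvd_X])
  obtain ⟨t, rfl⟩ := h
  refine ⟨t, ?_, rfl, ?_⟩
  · apply mul_left_cancel₀ (X_ne_zero (R := k) (1 : Fin 3))
    linear_combination -h₂
  · apply mul_left_cancel₀ (X_ne_zero (R := k) (1 : Fin 3))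
    linear_combination h₀

open ParityPart

/-- The projection of a polynomial onto its part of parity `a`. -/
def toParityPart (a : ZMod 2) (f : MvPolynomial (Fin 3) k) : ParityPart k a :=
  mk (parityComponent a f) (weightedHomogeneousComponent_isWeightedHomogeneous _ _)

lemma X_mul_toParityPart (i : Fin 3) {a b : ZMod 2} (h : 1 + a = b) (f : MvPolynomial (Fin 3) k) :
    X i * (toParityPart a f).val = parityComponent b (X i * f) :=
  (parityComponent_X_mul i h f).symm

variable (k)

/-- The map `(a, b, c) ↦ xa + yb + zc`. -/
def koszulSum : (Fin 3 → ParityPart k 0) →ₗ[Rv2 k] ParityPart k 1 :=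
  ∑ i, mulX i (add_zero 1) ∘ₗ LinearMap.proj i

/-- The map `t ↦ (xt, yt, zt)`. -/
def koszulDiag : ParityPart k 0 →ₗ[Rv2 k] (Fin 3 → ParityPart k 1) :=
  LinearMap.pi fun i => mulX i (add_zero 1)

variable {k}

lemma koszulSum_apply (v : Fin 3 → ParityPart k 0) :
    (koszulSum k v).val = X 0 * (v 0).val + X 1 * (v 1).val + X 2 * (v 2).val := by
  simp [koszulSum, Fin.sum_univ_three]

lemma koszulDiag_apply (t : ParityPart k 0) (i : Fin 3) :
    (koszulDiag k t i).val = X i * t.val := rfl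

variable (k) in
/-- The cross product with `(x, y, z)`. -/
def koszulCross : (Fin 3 → ParityPart k 1) →ₗ[Rv2 k] LinearMap.ker (koszulSum k) :=
  let m (i j : Fin 3) : (Fin 3 → ParityPart k 1) →ₗ[Rv2 k] ParityPart k 0 :=
    mulX i rfl ∘ₗ LinearMap.proj j
  LinearMap.codRestrict _ (LinearMap.pi ![m 1 2 - m 2 1, m 2 0 - m 0 2, m 0 1 - m 1 0]) (by
    intro v
    rw [LinearMap.mem_ker]
    ext1
    rw [koszulSum_apply]
    simp [m]
    ring)

lemma koszulCross_apply (v : Fin 3 → ParityPart k 1) :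
    ((koszulCross k v).1 0).val = X 1 * (v 2).val - X 2 * (v 1).val ∧
    ((koszulCross k v).1 1).val = X 2 * (v 0).val - X 0 * (v 2).val ∧
    ((koszulCross k v).1 2).val = X 0 * (v 1).val - X 1 * (v 0).val :=
  ⟨rfl, rfl, rfl⟩

lemma koszulSum_surjective : Function.Surjective (koszulSum k) := by
  intro f
  have hf : f.val ∈ Ideal.span (Set.range (X : Fin 3 → MvPolynomial (Fin 3) k)) := by
    rw [← Set.image_univ, mem_ideal_span_X_image]
    intro m hm
    by_contra! h
    have h0 : m = 0 := Finsupp.ext fun i => h i trivial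
    have := f.hasParity (mem_support_iff.1 hm)
    simp [h0] at this
  obtain ⟨c, hc⟩ := Ideal.mem_span_range_iff_exists_fun.1 hf
  refine ⟨fun i => toParityPart 0 (c i), ParityPart.ext ?_⟩
  rw [koszulSum_apply, ← f.hasParity.component_eq, ← hc, Fin.sum_univ_three]
  simp only [X_mul_toParityPart _ (add_zero (1 : ZMod 2)), parityComponent, map_add, mul_comm (c _)]

lemma koszulDiag_injective : Function.Injective (koszulDiag k) := by
  intro s t h
  refine ParityPart.ext (mul_left_cancel₀ (X_ne_zero (R := k) (0 : Fin 3)) ?_)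
  rw [← koszulDiag_apply, h, koszulDiag_apply]

lemma koszulCross_surjective : Function.Surjective (koszulCross k) := by
  intro v
  have hv := congrArg ParityPart.val (LinearMap.mem_ker.1 v.2)
  rw [koszulSum_apply] at hv
  obtain ⟨u₀, u₁, u₂, h₀, h₁, h₂⟩ := exists_cross_of_sum_eq_zero hv
  have key {a b : MvPolynomial (Fin 3) k} {i j : Fin 3} {c : ParityPart k 0}
      (h : X i * a - X j * b = c.val) :
      X i * (toParityPart 1 a).val - X j * (toParityPart 1 b).val = c.val := by
    rw [X_mul_toParityPart i (b := 0) rfl, X_mul_toParityPart j (b := 0) rfl,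
      ← c.hasParity.component_eq, ← h]
    exact (map_sub _ _ _).symm
  let u (i : Fin 3) : ParityPart k 1 := toParityPart 1 (![u₀, u₁, u₂] i)
  refine ⟨u, Subtype.ext (funext fun i => ParityPart.ext ?_)⟩
  obtain ⟨e₀, e₁, e₂⟩ := koszulCross_apply u
  fin_cases i
  · exact e₀.trans (key h₀)
  · exact e₁.trans (key h₁)
  · exact e₂.trans (key h₂)

lemma koszul_exact : Function.Exact (koszulDiag k) (koszulCross k) := by
  intro v
  obtain ⟨e₀, e₁, e₂⟩ := koszulCross_apply v
  constructor
  · intro hv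
    rw [hv] at e₀ e₂
    obtain ⟨t, h₀, h₁, h₂⟩ := exists_eq_mul_of_cross_eq_zero e₀.symm e₂.symm
    have key {i : Fin 3} (h : (v i).val = X i * t) :
        (koszulDiag k (toParityPart 0 t) i).val = (v i).val := by
      rw [koszulDiag_apply, X_mul_toParityPart i (add_zero (1 : ZMod 2)), ← h]
      exact (v i).hasParity.component_eq
    refine ⟨toParityPart 0 t, funext fun i => ParityPart.ext ?_⟩
    fin_cases i
    · exact key h₀
    · exact key h₁
    · exact key h₂
  · rintro ⟨t, rfl⟩
    simp only [koszulDiag_apply] at e₀ e₁ e₂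
    refine Subtype.ext (funext fun i => ParityPart.ext ?_)
    fin_cases i
    · exact e₀.trans (by simp; ring)
    · exact e₁.trans (by simp; ring)
    · exact e₂.trans (by simp; ring)

lemma koszulDiag_zero (t : ParityPart k 0) :
    koszulDiag k t 0 = koszulSum k (Pi.single 0 t) := by
  ext1
  simp [koszulSum_apply, koszulDiag_apply]

lemma evenEquiv_symm_mem (v : LinearMap.ker (koszulSum k)) (i : Fin 3) :
    (evenEquiv k).symm (v.1 i) ∈ mV2 k := by
  have hv := congrArg ParityPart.val (LinearMap.mem_ker.1 v.2)
  rw [koszulSum_apply] at hv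
  have h := congrArg (coeff (Finsupp.single i 1)) hv
  change constantCoeff (v.1 i).val = 0
  rw [constantCoeff_eq]
  fin_cases i <;> simpa [coeff_X_mul', Finsupp.single_apply] using h

variable (k) in
lemma hasDim_quotient : HasDim (A := Rv2 k) k (Rv2 k ⧸ mV2 k) 1 := by
  let φ : Rv2 k →ₐ[k] k := (aeval 0).comp (Rv2 k).val
  have hφ : RingHom.ker φ = mV2 k := by
    ext f
    simp [φ, mV2, RingHom.mem_ker]
  have hs : Function.Surjective φ := fun c => ⟨algebraMap k _ c, by simp⟩
  rw [← hφ, hasDim_iff]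
  have e := (Ideal.quotientKerAlgEquivOfSurjective hs).toLinearEquiv
  exact ⟨Module.Finite.equiv e.symm, e.finrank_eq.trans (Module.finrank_self k)⟩

end Parity

section Frobenius
open ParityPart
variable {k} {q : ℕ}

/-- An exponent vector with entries less than `q`, as a finitely supported function. -/
def expVec (r : Fin 3 → Fin q) : Fin 3 →₀ ℕ := Finsupp.equivFunOnFinite.symm fun i => r i

@[simp]
lemma expVec_apply (r : Fin 3 → Fin q) (i : Fin 3) : expVec r i = r i := rfl

/-- The parity of the degree of an exponent vector. -/
def parity (r : Fin 3 → Fin q) : ZMod 2 := Finsupp.weight (1 : Fin 3 → ZMod 2) (expVec r)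

/-- The polynomial `∑ r, X ^ r * (g r) ^ q`, summed over exponent vectors with entries less
than `q`. -/
def frobeniusSum (g : ∀ r : Fin 3 → Fin q, ParityPart k (parity r)) : MvPolynomial (Fin 3) k :=
  ∑ r, monomial (expVec r) 1 * (g r).val ^ q

lemma frobeniusSum_mem (hq : Odd q) (g : ∀ r : Fin 3 → Fin q, ParityPart k (parity r)) :
    frobeniusSum g ∈ Rv2 k := by
  refine sum_mem fun r _ => mem_Rv2_iff.2 ?_
  have h := (isWeightedHomogeneous_monomial (1 : Fin 3 → ZMod 2) (expVec r) (1 : k)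
    (m := parity r) rfl).mul ((g r).hasParity.pow q)
  rwa [nsmul_eq_mul, ZMod.natCast_eq_one_iff_odd.2 hq, one_mul, CharTwo.add_self_eq_zero] at h

lemma frobeniusSum_single (r : Fin 3 → Fin q) (f : ParityPart k (parity r)) (hq : q ≠ 0) :
    frobeniusSum (Pi.single r f) = monomial (expVec r) 1 * f.val ^ q := by
  rw [frobeniusSum, Finset.sum_eq_single r]
  · simp
  · intro s _ hs
    simp [Pi.single_eq_of_ne hs, hq]
  · simp

lemma frobeniusSum_smul (a : Rv2 k) (g : ∀ r : Fin 3 → Fin (q), ParityPart k (parity r)) :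
    frobeniusSum (a • g) = a.1 ^ q * frobeniusSum g := by
  simp [frobeniusSum, val_smul, mul_pow, Finset.mul_sum, mul_left_comm]

variable {p : ℕ} [Fact p.Prime] [CharP k p] {e : ℕ}

lemma frobeniusSum_add (g h : ∀ r : Fin 3 → Fin (p ^ e), ParityPart k (parity r)) :
    frobeniusSum (g + h) = frobeniusSum g + frobeniusSum h := by
  simp [frobeniusSum, add_pow_char_pow, mul_add, Finset.sum_add_distrib]

lemma coeff_frobeniusSum (g : ∀ r : Fin 3 → Fin (p ^ e), ParityPart k (parity r))
    (r : Fin 3 → Fin (p ^ e)) (u : Fin 3 →₀ ℕ) :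
    coeff (expVec r + p ^ e • u) (frobeniusSum g) = coeff u (g r).val ^ p ^ e := by
  have hp : p ^ e ≠ 0 := pow_ne_zero _ (Fact.out : p.Prime).ne_zero
  rw [frobeniusSum, coeff_sum, Finset.sum_eq_single r]
  · rw [coeff_monomial_mul, one_mul, ← map_iterateFrobenius_expand, coeff_map,
      coeff_expand_smul _ hp, iterateFrobenius_def]
  · intro s _ hs
    rw [coeff_monomial_mul']
    split_ifs with hle
    · obtain ⟨i, hi⟩ := Function.ne_iff.1 hs
      have hle := hle i
      rw [← map_iterateFrobenius_expand, coeff_map, coeff_expand_of_not_dvd (i := i), map_zero,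
        mul_zero]
      intro hd
      simp only [Finsupp.coe_add, Finsupp.coe_smul, Pi.add_apply, Pi.smul_apply, smul_eq_mul,
        expVec_apply, Finsupp.coe_tsub, Pi.sub_apply] at hd hle
      have hmod := (Nat.modEq_iff_dvd' hle).2 hd
      rw [Nat.ModEq, Nat.add_mul_mod_self_left, Nat.mod_eq_of_lt (s i).2,
        Nat.mod_eq_of_lt (r i).2] at hmod
      exact hi (Fin.ext hmod)
    · rfl
  · simp

/-- The decomposition of `ᵉR` into copies of the even and the odd part of `k[x,y,z]`. -/
def frobeniusDecomposition (hq : Odd (p ^ e)) :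
    (∀ r : Fin 3 → Fin (p ^ e), ParityPart k (parity r)) →ₗ[Rv2 k] eRv2 k p e where
  toFun g := (⟨frobeniusSum g, frobeniusSum_mem hq g⟩ : Rv2 k)
  map_add' g h := Subtype.ext (frobeniusSum_add g h)
  map_smul' a g := Subtype.ext (frobeniusSum_smul a g)

lemma frobeniusDecomposition_injective (hq : Odd (p ^ e)) :
    Function.Injective (frobeniusDecomposition (k := k) hq) := by
  rw [injective_iff_map_eq_zero]
  intro g hg
  have h : frobeniusSum g = 0 := congrArg Subtype.val hg
  ext r u
  have := coeff_frobeniusSum g r u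
  rw [h, coeff_zero] at this
  simpa using eq_zero_of_pow_eq_zero this.symm

lemma frobeniusDecomposition_surjective [IsAlgClosed k] (hq : Odd (p ^ e)) :
    Function.Surjective (frobeniusDecomposition (k := k) hq) := by
  intro (f : Rv2 k)
  suffices h : f.1 ∈ Set.range (frobeniusSum (k := k) (q := p ^ e)) by
    obtain ⟨g, hg⟩ := h
    exact ⟨g, Subtype.ext hg⟩
  have h0 : 0 < p ^ e := pow_pos (Fact.out : p.Prime).pos _
  let φ : (∀ r : Fin 3 → Fin (p ^ e), ParityPart k (parity r)) →+ MvPolynomial (Fin 3) k :=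
    AddMonoidHom.mk' frobeniusSum frobeniusSum_add
  change f.1 ∈ φ.range
  rw [f.1.as_sum]
  refine sum_mem fun d hd => ?_
  let r (i : Fin 3) : Fin (p ^ e) := ⟨d i % p ^ e, Nat.mod_lt _ h0⟩
  let u : Fin 3 →₀ ℕ := Finsupp.equivFunOnFinite.symm fun i => d i / p ^ e
  have hd' : d = expVec r + p ^ e • u := by
    ext i
    exact (Nat.mod_add_div _ _).symm
  obtain ⟨c, hc⟩ := IsAlgClosed.exists_pow_nat_eq (coeff d f.1) h0
  have hu : Finsupp.weight (1 : Fin 3 → ZMod 2) u = parity r := by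
    have h := mem_Rv2_iff.1 f.2 (mem_support_iff.1 hd)
    rw [hd', map_add, map_nsmul, nsmul_eq_mul, ZMod.natCast_eq_one_iff_odd.2 hq,
      one_mul, CharTwo.add_eq_zero] at h
    exact h.symm
  refine ⟨Pi.single r (mk (monomial u c) (isWeightedHomogeneous_monomial _ _ _ hu)), ?_⟩
  change frobeniusSum _ = _
  rw [frobeniusSum_single _ _ h0.ne', val_mk, monomial_pow, monomial_mul, ← hd', one_mul, hc]

/-- The number of exponent vectors of odd degree. -/
lemma two_mul_card_odd (hq : Odd q) :
    2 * (Finset.univ.filter fun r : Fin 3 → Fin q => parity r ≠ 0).card + 1 = q ^ 3 := by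
  have h1 : ∑ i : Fin q, (-1 : ℤ) ^ (i : ℕ) = 1 := by
    rw [Fin.sum_univ_eq_sum_range (fun i => (-1 : ℤ) ^ i), neg_one_geom_sum,
      if_neg (Nat.not_even_iff_odd.2 hq)]
  have h2 : ∑ r : Fin 3 → Fin q, ∏ i, (-1 : ℤ) ^ (r i : ℕ) = 1 := by
    rw [← Fintype.sum_pow (fun i : Fin q => (-1 : ℤ) ^ (i : ℕ)), h1, one_pow]
  have h3 (r : Fin 3 → Fin q) :
      ∏ i, (-1 : ℤ) ^ (r i : ℕ) = 1 - 2 * if parity r ≠ 0 then 1 else 0 := by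
    have hr : parity r = 0 ↔ Even (r 0 + r 1 + r 2 : ℕ) := by
      rw [parity, weight_eq_sum, ZMod.natCast_eq_zero_iff_even]
      rfl
    rw [Fin.prod_univ_three, ← pow_add, ← pow_add]
    simp only [ne_eq, hr]
    by_cases h : Even (r 0 + r 1 + r 2 : ℕ)
    · simp [h]
    · simp [h, (Nat.not_even_iff_odd.1 h).neg_one_pow]
  simp only [h3, Finset.sum_sub_distrib, ← Finset.mul_sum, Finset.sum_boole] at h2
  simp at h2
  zify
  simp
  linarith

end Frobenius

section Betti
open TorResolution ParityPart
variable {k}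

lemma hasDim_torFunctor_parityPart
    (P : ProjectiveResolution (ModuleCat.of (Rv2 k) (Rv2 k ⧸ mV2 k)))
    (n : ℕ) (a : ZMod 2) :
    HasDim (A := Rv2 k) k ((torFunctor P (n + 1)).obj (.of _ (ParityPart k a)))
      (if a ≠ 0 then 8 * 3 ^ n else 0) := by
  split_ifs with h
  · obtain rfl : a = 1 := by revert h; decide +revert
    exact hasDim_torFunctor_succ P (hasDim_quotient k) (evenEquiv k) Subtype.val_injective
      koszulSum_surjective (LinearMap.exact_subtype_ker_map _) koszulDiag_injective
      koszulCross_surjective koszul_exact evenEquiv_symm_mem koszulDiag_zero n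
  · obtain rfl : a = 0 := not_not.1 h
    have : Module.Flat (Rv2 k) (ModuleCat.of (Rv2 k) (ParityPart k 0)) :=
      Module.Flat.of_linearEquiv (evenEquiv k).symm
    have := ModuleCat.subsingleton_of_isZero
      (isZero_torFunctor_succ P (.of (Rv2 k) (ParityPart k 0)) n)
    exact HasDim.of_subsingleton

lemma bettiV2_eRv2 (p : ℕ) [Fact p.Prime] [CharP k p] [IsAlgClosed k] (e n : ℕ)
    (hq : Odd (p ^ e)) : bettiV2 k (n + 1) (eRv2 k p e) =
      (Finset.univ.filter fun r : Fin 3 → Fin (p ^ e) => parity r ≠ 0).card * (8 * 3 ^ n) := by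
  let P : ProjectiveResolution (ModuleCat.of (Rv2 k) (Rv2 k ⧸ mV2 k)) :=
    ProjectiveResolution.of _
  let ε := LinearEquiv.ofBijective (frobeniusDecomposition (k := k) hq)
    ⟨frobeniusDecomposition_injective hq, frobeniusDecomposition_surjective hq⟩
  obtain ⟨ι⟩ := nonempty_torFunctor_pi_equiv P (n + 1)
    (fun r : Fin 3 → Fin (p ^ e) => ModuleCat.of (Rv2 k) (ParityPart k (parity r)))
  have h := HasDim.pi fun r : Fin 3 → Fin (p ^ e) => hasDim_torFunctor_parityPart P n (parity r)
  have h2 := hasDim_of_iso h (ι.symm ≪≫ (torFunctor P (n + 1)).mapIso ε.toModuleIso ≪≫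
    (torIso P (n + 1) (.of _ (eRv2 k p e))).symm)
  rw [bettiV2, h2.finrank_restrictScalars, ← Finset.sum_filter, Finset.sum_const, smul_eq_mul]

end Betti

theorem frobeniusBetti_veronese2 (p : ℕ) [Fact p.Prime] (k : Type) [Field k] [IsAlgClosed k]
    [CharP k p] (hp : 2 < p) (i : ℕ) (hi : 1 ≤ i) :
    Tendsto (fun e : ℕ => (bettiV2 k i ↥(eRv2 k p e) : ℝ) / (p : ℝ) ^ (3 * e)) atTop
      (nhds (4 * 3 ^ (i - 1))) := by
  obtain ⟨n, rfl⟩ := Nat.exists_eq_add_of_le' hi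
  have hp' : (1 : ℝ) < (p : ℝ) ^ 3 :=
    one_lt_pow₀ (by exact_mod_cast (by omega : 1 < p)) (by norm_num)
  have h (e : ℕ) : (bettiV2 k (n + 1) (eRv2 k p e) : ℝ) / (p : ℝ) ^ (3 * e) =
      4 * 3 ^ n * (1 - (((p : ℝ) ^ 3)⁻¹) ^ e) := by
    have hq : Odd (p ^ e) := ((Fact.out : p.Prime).odd_of_ne_two hp.ne').pow
    have hc := two_mul_card_odd hq
    rw [bettiV2_eRv2 p e n hq]
    generalize (Finset.univ.filter fun r : Fin 3 → Fin (p ^ e) => parity r ≠ 0).card = N at hc ⊢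
    have hc' : 2 * (N : ℝ) + 1 = ((p : ℝ) ^ 3) ^ e := by
      rw [← pow_mul, mul_comm 3 e, pow_mul]
      exact_mod_cast hc
    have : ((p : ℝ) ^ 3) ^ e ≠ 0 := by positivity
    rw [pow_mul, inv_pow]
    push_cast
    field_simp
    linear_combination 4 * hc'
  simp only [h, Nat.add_sub_cancel]
  have := (tendsto_pow_atTop_nhds_zero_of_lt_one (inv_nonneg.2 (zero_le_one.trans hp'.le))
    (inv_lt_one_of_one_lt₀ hp')).const_sub 1 |>.const_mul (4 * 3 ^ n : ℝ)
  simpa using this
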